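/- Data processing for coherent information: if ρ_{A₁A} is a bipartite density operator and N : D(H_A) → D(H_B) is a completely positive trace-preserving map, then I(A₁⟩B)_{(id⊗N)(ρ)} ≤ I(A₁⟩A)_ρ, where I(X⟩Y)_σ = H(σ_Y) - H(σ_{XY}). -/

import Mathlib

open Matrix Kronecker Finset
open scoped ComplexOrder

noncomputable section

namespace QRelay

variable {n : Type*} [Fintype n] [DecidableEq n]

/-- Von Neumann entropy (in bits) of a matrix, via its eigenvalues when Hermitian. -/
def vN (ρ : Matrix n n ℂ) : ℝ :=
  if h : ρ.IsHermitian then -∑ i, h.eigenvalues i * Real.logb 2 (h.eigenvalues i) else 0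

/-- A density operator: positive semidefinite with unit trace. -/
def IsDensity (ρ : Matrix n n ℂ) : Prop := ρ.PosSemidef ∧ ρ.trace = 1

/-- Trace norm: the sum of singular values. -/
def trNorm (X : Matrix n n ℂ) : ℝ :=
  ∑ i, Real.sqrt ((Matrix.posSemidef_conjTranspose_mul_self X).1.eigenvalues i)

/-- Partial trace over the first tensor factor. -/
def ptrFst {A B : Type*} [Fintype A] [Fintype B] (ρ : Matrix (A × B) (A × B) ℂ) :
    Matrix B B ℂ :=
  Matrix.of fun b b' => ∑ a, ρ (a, b) (a, b')

/-- Partial trace over the second tensor factor. -/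
def ptrSnd {A B : Type*} [Fintype A] [Fintype B] (ρ : Matrix (A × B) (A × B) ℂ) :
    Matrix A A ℂ :=
  Matrix.of fun a a' => ∑ b, ρ (a, b) (a', b)

/-- Binary entropy (base 2). -/
def binEnt (ε : ℝ) : ℝ := -(ε * Real.logb 2 ε) - (1 - ε) * Real.logb 2 (1 - ε)

end QRelay

namespace QRelay
/-- scalar comparison function -/
def GG {I J : Type*} [Fintype I] [Fintype J] (p : I → ℝ) (q : J → ℝ) (c : I → J → ℝ) (t : ℝ) : ℝ :=
  ∑ i, ∑ j, c i j * p i * Real.log (q j + t * p i)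

def FF {I J : Type*} [Fintype I] [Fintype J] (p : I → ℝ) (q : J → ℝ) (c : I → J → ℝ) (t : ℝ) : ℝ :=
  ∑ i, ∑ j, c i j * (p i ^ 2 / (q j + t * p i))

section scalar
variable {I J I' J' : Type*} [Fintype I] [Fintype J] [Fintype I'] [Fintype J']

lemma GG_deriv (p : I → ℝ) (q : J → ℝ) (c : I → J → ℝ) (hp : ∀ i, 0 ≤ p i) (hq : ∀ j, 0 ≤ q j)
    {t : ℝ} (ht : 0 < t) : HasDerivAt (GG p q c) (FF p q c t) t := by
  unfold GG FF
  refine HasDerivAt.fun_sum fun i _ => HasDerivAt.fun_sum fun j _ => ?_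
  rcases (hp i).eq_or_lt with h | h
  · simp [← h, hasDerivAt_const]
  · have hpos : 0 < q j + t * p i := by have := hq j; positivity
    have h1 : HasDerivAt (fun t => q j + t * p i) (p i) t := by
      simpa using ((hasDerivAt_id t).mul_const (p i)).const_add (q j)
    have h2 := (h1.log hpos.ne').const_mul (c i j * p i)
    exact h2.congr_deriv (by ring)

lemma GG_top (p : I → ℝ) (q : J → ℝ) (c : I → J → ℝ) (hp : ∀ i, 0 ≤ p i) (hq : ∀ j, 0 ≤ q j)
    (hc : ∀ i, ∑ j, c i j = 1) (hs : ∑ i, p i = 1) :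
    Filter.Tendsto (fun t => GG p q c t - Real.log t) Filter.atTop
      (nhds (∑ i, p i * Real.log (p i))) := by
  have e : ∑ i, p i * Real.log (p i) = ∑ i, ∑ j, c i j * p i * Real.log (p i) := by
    refine Finset.sum_congr rfl fun i _ => ?_
    rw [← Finset.sum_mul, ← Finset.sum_mul, hc, one_mul]
  rw [e]
  have key : Filter.Tendsto (fun t => ∑ i, ∑ j, c i j * p i * Real.log (q j * t⁻¹ + p i))
      Filter.atTop (nhds (∑ i, ∑ j, c i j * p i * Real.log (p i))) := by
    refine tendsto_finsetSum _ fun i _ => tendsto_finsetSum _ fun j _ => ?_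
    rcases (hp i).eq_or_lt with h | h
    · simp [← h]
    · refine Filter.Tendsto.const_mul _ ?_
      refine Filter.Tendsto.log ?_ h.ne'
      simpa using ((tendsto_inv_atTop_zero (𝕜 := ℝ)).const_mul (q j)).add_const (p i)
  refine key.congr' ?_
  filter_upwards [Filter.eventually_gt_atTop 0] with t ht
  have e2 : Real.log t = ∑ i, ∑ j, c i j * p i * Real.log t := by
    simp_rw [← Finset.sum_mul, hc, one_mul, hs, one_mul]
  rw [e2, GG, ← Finset.sum_sub_distrib]
  refine Finset.sum_congr rfl fun i _ => ?_
  rw [← Finset.sum_sub_distrib]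
  refine Finset.sum_congr rfl fun j _ => ?_
  rcases (hp i).eq_or_lt with h | h
  · simp [← h]
  · have hpos : 0 < q j + t * p i := by have := hq j; positivity
    rw [← mul_sub, ← Real.log_div hpos.ne' ht.ne']
    congr 2
    field_simp

lemma GG_zero (p : I → ℝ) (q : J → ℝ) (c : I → J → ℝ)
    (hz : ∀ i j, q j = 0 → c i j * p i = 0) :
    Filter.Tendsto (fun t => GG p q c t) (nhdsWithin 0 (Set.Ioi 0))
      (nhds (∑ i, ∑ j, c i j * p i * Real.log (q j))) := by
  refine tendsto_finsetSum _ fun i _ => tendsto_finsetSum _ fun j _ => ?_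
  by_cases h : q j = 0
  · simp [hz i j h]
  · refine Filter.Tendsto.const_mul _ (Filter.Tendsto.log ?_ h)
    refine tendsto_nhdsWithin_of_tendsto_nhds ?_
    have : Continuous fun t : ℝ => q j + t * p i := by fun_prop
    simpa using this.tendsto 0

lemma scalar_main (p : I → ℝ) (q : J → ℝ) (c : I → J → ℝ) (hp : ∀ i, 0 ≤ p i) (hq : ∀ j, 0 ≤ q j)
    (hc : ∀ i, ∑ j, c i j = 1) (hs : ∑ i, p i = 1)
    (hz : ∀ i j, q j = 0 → c i j * p i = 0)
    (p' : I' → ℝ) (q' : J' → ℝ) (c' : I' → J' → ℝ) (hp' : ∀ i, 0 ≤ p' i) (hq' : ∀ j, 0 ≤ q' j)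
    (hc' : ∀ i, ∑ j, c' i j = 1) (hs' : ∑ i, p' i = 1)
    (hz' : ∀ i j, q' j = 0 → c' i j * p' i = 0)
    (hF : ∀ t, 0 < t → FF p' q' c' t ≤ FF p q c t) :
    ∑ i, ∑ j, c i j * p i * Real.log (q j) - ∑ i, ∑ j, c' i j * p' i * Real.log (q' j) ≤
    ∑ i, p i * Real.log (p i) - ∑ i, p' i * Real.log (p' i) := by
  have hmono : MonotoneOn (fun t => GG p q c t - GG p' q' c' t) (Set.Ioi 0) := by
    have hd : ∀ t ∈ Set.Ioi (0:ℝ), HasDerivAt (fun t => GG p q c t - GG p' q' c' t)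
        (FF p q c t - FF p' q' c' t) t := fun t ht =>
      (GG_deriv p q c hp hq ht).fun_sub (GG_deriv p' q' c' hp' hq' ht)
    refine monotoneOn_of_deriv_nonneg (convex_Ioi 0)
      (fun t ht => (hd t ht).continuousAt.continuousWithinAt) ?_ ?_
    · rw [interior_Ioi]
      exact fun t ht => (hd t ht).differentiableAt.differentiableWithinAt
    · rw [interior_Ioi]
      intro t ht
      rw [(hd t ht).deriv]
      exact sub_nonneg.2 (hF t ht)
  have h0 := (GG_zero p q c hz).sub (GG_zero p' q' c' hz')
  have h1 := (GG_top p q c hp hq hc hs).sub (GG_top p' q' c' hp' hq' hc' hs')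
  have a : ∀ T : ℝ, 0 < T → ∑ i, ∑ j, c i j * p i * Real.log (q j)
      - ∑ i, ∑ j, c' i j * p' i * Real.log (q' j) ≤ GG p q c T - GG p' q' c' T := by
    intro T hT
    refine le_of_tendsto h0 ?_
    filter_upwards [Ioo_mem_nhdsGT hT] with t ht
    exact hmono ht.1 hT ht.2.le
  refine ge_of_tendsto h1 ?_
  filter_upwards [Filter.eventually_gt_atTop 0] with T hT
  have := a T hT
  linarith
end scalar

section mat
variable {n m : Type*} [Fintype n] [DecidableEq n] [Fintype m] [DecidableEq m]

def val (t : ℝ) (ρ σ X : Matrix n n ℂ) : ℝ :=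
  2 * (Xᴴ * ρ).trace.re - (σ * (X * Xᴴ)).trace.re - t * (ρ * (Xᴴ * X)).trace.re

lemma ks {ι : Type*} (s : Finset ι) (L : ι → Matrix m n ℂ) (hL : ∑ k ∈ s, (L k)ᴴ * L k = 1)
    (σ : Matrix n n ℂ) (hσ : σ.PosSemidef) (X : Matrix m m ℂ) :
    (σ * ((∑ k ∈ s, (L k)ᴴ * X * L k)ᴴ * (∑ k ∈ s, (L k)ᴴ * X * L k))).trace.re ≤
      ((∑ k ∈ s, L k * σ * (L k)ᴴ) * (Xᴴ * X)).trace.re := by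
  set E := ∑ k ∈ s, (L k)ᴴ * X * L k with hE
  have hEH : Eᴴ = ∑ k ∈ s, (L k)ᴴ * Xᴴ * L k := by
    simp [hE, conjTranspose_sum, Matrix.mul_assoc]
  have id1 : ∑ k ∈ s, (X * L k - L k * E)ᴴ * (X * L k - L k * E)
      = (∑ k ∈ s, (L k)ᴴ * (Xᴴ * X) * L k) - Eᴴ * E := by
    have : ∀ k ∈ s, (X * L k - L k * E)ᴴ * (X * L k - L k * E) =
        (L k)ᴴ * (Xᴴ * X) * L k - ((L k)ᴴ * Xᴴ * L k) * E - Eᴴ * ((L k)ᴴ * X * L k)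
          + Eᴴ * ((L k)ᴴ * L k) * E := by
      intro k _
      simp only [conjTranspose_sub, conjTranspose_mul]
      simp only [Matrix.sub_mul, Matrix.mul_sub, Matrix.mul_assoc]
      abel
    rw [Finset.sum_congr rfl this, Finset.sum_add_distrib, Finset.sum_sub_distrib,
      Finset.sum_sub_distrib, ← Finset.sum_mul, ← Finset.mul_sum, ← Finset.sum_mul,
      ← Finset.mul_sum, hL, ← hE, ← hEH]
    simp
  have e2 : ((∑ k ∈ s, L k * σ * (L k)ᴴ) * (Xᴴ * X)).trace
      = (σ * ∑ k ∈ s, (L k)ᴴ * (Xᴴ * X) * L k).trace := by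
    rw [Finset.sum_mul, Finset.mul_sum, trace_sum, trace_sum]
    refine Finset.sum_congr rfl fun k _ => ?_
    rw [Matrix.mul_assoc, Matrix.mul_assoc, trace_mul_comm, Matrix.mul_assoc, Matrix.mul_assoc]
  have e3 : (∑ k ∈ s, (L k)ᴴ * (Xᴴ * X) * L k) =
      (∑ k ∈ s, (X * L k - L k * E)ᴴ * (X * L k - L k * E)) + Eᴴ * E := by
    rw [id1]; simp
  rw [e2, e3, Matrix.mul_add, trace_add, Complex.add_re]
  have : 0 ≤ (σ * ∑ k ∈ s, (X * L k - L k * E)ᴴ * (X * L k - L k * E)).trace.re := by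
    rw [Finset.mul_sum, trace_sum, Complex.re_sum]
    refine Finset.sum_nonneg fun k _ => ?_
    rw [← Matrix.mul_assoc, trace_mul_comm, ← Matrix.mul_assoc]
    have := (hσ.mul_mul_conjTranspose_same (X * L k - L k * E)).trace_nonneg
    exact (Complex.le_def.1 this).1
  linarith

lemma val_le {ι : Type*} (s : Finset ι) (L : ι → Matrix m n ℂ) (hL : ∑ k ∈ s, (L k)ᴴ * L k = 1)
    (ρ σ : Matrix n n ℂ) (hρ : ρ.PosSemidef) (hσ : σ.PosSemidef) (X : Matrix m m ℂ) {t : ℝ}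
    (ht : 0 < t) :
    val t (∑ k ∈ s, L k * ρ * (L k)ᴴ) (∑ k ∈ s, L k * σ * (L k)ᴴ) X ≤
      val t ρ σ (∑ k ∈ s, (L k)ᴴ * X * L k) := by
  have h1 := ks s L hL ρ hρ X
  have h2 := ks s L hL σ hσ Xᴴ
  have hEH : ∑ k ∈ s, (L k)ᴴ * Xᴴ * L k = (∑ k ∈ s, (L k)ᴴ * X * L k)ᴴ := by
    simp [conjTranspose_sum, Matrix.mul_assoc]
  have h3 : (Xᴴ * ∑ k ∈ s, L k * ρ * (L k)ᴴ).trace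
      = ((∑ k ∈ s, (L k)ᴴ * X * L k)ᴴ * ρ).trace := by
    rw [← hEH, Finset.sum_mul, Finset.mul_sum, trace_sum, trace_sum]
    refine Finset.sum_congr rfl fun k _ => ?_
    rw [← Matrix.mul_assoc, trace_mul_comm]
    simp only [Matrix.mul_assoc]
  rw [hEH] at h2
  simp only [conjTranspose_conjTranspose] at h2
  unfold val
  rw [h3]
  have := mul_le_mul_of_nonneg_left h1 ht.le
  linarith

lemma trace_DYY (q : n → ℝ) (Y : Matrix n n ℂ) :
    (diagonal (fun j => (q j : ℂ)) * (Y * Yᴴ)).trace.re = ∑ j, ∑ i, q j * Complex.normSq (Y j i) := by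
  simp only [trace, diag_apply, diagonal_mul, Complex.re_sum, Complex.re_ofReal_mul]
  refine Finset.sum_congr rfl fun j _ => ?_
  rw [mul_apply, Complex.re_sum, Finset.mul_sum]
  refine Finset.sum_congr rfl fun i _ => ?_
  rw [conjTranspose_apply, Complex.star_def, Complex.mul_conj, Complex.ofReal_re]

lemma val_coord (p q : n → ℝ) (U W Y : Matrix n n ℂ) (hU : Uᴴ * U = 1) (hW : Wᴴ * W = 1) (t : ℝ) :
    val t (U * diagonal (fun i => (p i : ℂ)) * Uᴴ) (W * diagonal (fun i => (q i : ℂ)) * Wᴴ)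
      (W * Y * Uᴴ) =
    ∑ i, ∑ j, (2 * (p i * (star (Y j i) * (Wᴴ * U) j i).re)
      - (q j + t * p i) * Complex.normSq (Y j i)) := by
  set P := diagonal (fun i => (p i : ℂ))
  set Q := diagonal (fun i => (q i : ℂ))
  have a1 : ((W * Y * Uᴴ)ᴴ * (U * P * Uᴴ)).trace = (Yᴴ * (Wᴴ * U) * P).trace := by
    calc _ = (U * (Yᴴ * Wᴴ * U * P * Uᴴ)).trace := by
          simp only [conjTranspose_mul, conjTranspose_conjTranspose, Matrix.mul_assoc]
      _ = (Yᴴ * Wᴴ * U * P * (Uᴴ * U)).trace := by rw [trace_mul_comm, Matrix.mul_assoc]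
      _ = _ := by rw [hU]; simp only [Matrix.mul_assoc, Matrix.mul_one]
  have a2 : (W * Q * Wᴴ * (W * Y * Uᴴ * (W * Y * Uᴴ)ᴴ)).trace = (Q * (Y * Yᴴ)).trace := by
    calc _ = (W * (Q * (Wᴴ * W) * Y * (Uᴴ * U) * Yᴴ * Wᴴ)).trace := by
          simp only [conjTranspose_mul, conjTranspose_conjTranspose, Matrix.mul_assoc]
      _ = (Q * (Wᴴ * W) * Y * (Uᴴ * U) * Yᴴ * (Wᴴ * W)).trace := by
          rw [trace_mul_comm, Matrix.mul_assoc]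
      _ = _ := by rw [hU, hW]; simp only [Matrix.mul_assoc, Matrix.mul_one, Matrix.one_mul]
  have a3 : (U * P * Uᴴ * ((W * Y * Uᴴ)ᴴ * (W * Y * Uᴴ))).trace = (P * (Yᴴ * Yᴴᴴ)).trace := by
    calc _ = (U * (P * (Uᴴ * U) * Yᴴ * (Wᴴ * W) * Y * Uᴴ)).trace := by
          simp only [conjTranspose_mul, conjTranspose_conjTranspose, Matrix.mul_assoc]
      _ = (P * (Uᴴ * U) * Yᴴ * (Wᴴ * W) * Y * (Uᴴ * U)).trace := by
          rw [trace_mul_comm, Matrix.mul_assoc]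
      _ = _ := by
        rw [hU, hW]
        simp only [Matrix.mul_assoc, Matrix.mul_one, Matrix.one_mul, conjTranspose_conjTranspose]
  have b1 : (Yᴴ * (Wᴴ * U) * P).trace.re
      = ∑ i, ∑ j, p i * (star (Y j i) * (Wᴴ * U) j i).re := by
    simp only [trace, diag_apply, P, mul_diagonal]
    rw [Complex.re_sum]
    refine Finset.sum_congr rfl fun i _ => ?_
    rw [mul_comm, Complex.re_ofReal_mul, mul_apply, Complex.re_sum, Finset.mul_sum]
    rfl
  unfold val
  rw [a1, a2, a3, b1, trace_DYY, trace_DYY]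
  rw [Finset.sum_comm (f := fun j i => q j * Complex.normSq (Y j i))]
  simp only [Finset.mul_sum, ← Finset.sum_sub_distrib]
  refine Finset.sum_congr rfl fun i _ => Finset.sum_congr rfl fun j _ => ?_
  simp only [conjTranspose_apply, Complex.star_def, Complex.normSq_conj]
  ring

lemma val_upper (p q : n → ℝ) (U W X : Matrix n n ℂ) (hU : Uᴴ * U = 1) (hW : Wᴴ * W = 1) {t : ℝ}
    (ht : 0 < t) (hp : ∀ i, 0 ≤ p i) (hq : ∀ j, 0 ≤ q j) :
    val t (U * diagonal (fun i => (p i : ℂ)) * Uᴴ) (W * diagonal (fun i => (q i : ℂ)) * Wᴴ) X ≤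
      FF p q (fun i j => Complex.normSq ((Wᴴ * U) j i)) t := by
  have hU' : U * Uᴴ = 1 := mul_eq_one_comm.1 hU
  have hW' : W * Wᴴ = 1 := mul_eq_one_comm.1 hW
  have hX : X = W * (Wᴴ * X * U) * Uᴴ := by
    calc X = (W * Wᴴ) * X * (U * Uᴴ) := by rw [hU', hW']; simp
      _ = _ := by simp only [Matrix.mul_assoc]
  rw [hX, val_coord p q U W _ hU hW, FF]
  refine Finset.sum_le_sum fun i _ => Finset.sum_le_sum fun j _ => ?_
  generalize (Wᴴ * X * U) j i = y
  generalize (Wᴴ * U) j i = z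
  rcases (hp i).eq_or_lt with h | h
  · rw [← h]
    have := mul_nonneg (hq j) (Complex.normSq_nonneg y)
    simp; linarith
  · have hpos : 0 < q j + t * p i := by have := hq j; positivity
    generalize q j + t * p i = r at *
    rw [← mul_div_assoc, le_div_iff₀ hpos]
    simp only [Complex.normSq_apply, Complex.star_def, Complex.mul_re, Complex.conj_re,
      Complex.conj_im]
    nlinarith [sq_nonneg (p i * z.re - r * y.re), sq_nonneg (p i * z.im - r * y.im)]

lemma val_attained (p q : n → ℝ) (U W : Matrix n n ℂ) (hU : Uᴴ * U = 1) (hW : Wᴴ * W = 1) {t : ℝ}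
    (ht : 0 < t) (hp : ∀ i, 0 ≤ p i) (hq : ∀ j, 0 ≤ q j) :
    ∃ X, val t (U * diagonal (fun i => (p i : ℂ)) * Uᴴ) (W * diagonal (fun i => (q i : ℂ)) * Wᴴ) X =
      FF p q (fun i j => Complex.normSq ((Wᴴ * U) j i)) t := by
  refine ⟨W * (Matrix.of fun j i => (((p i / (q j + t * p i) : ℝ) : ℂ) * (Wᴴ * U) j i)) * Uᴴ, ?_⟩
  rw [val_coord p q U W _ hU hW, FF]
  refine Finset.sum_congr rfl fun i _ => Finset.sum_congr rfl fun j _ => ?_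
  simp only [Matrix.of_apply]
  generalize (Wᴴ * U) j i = z
  rcases (hp i).eq_or_lt with h | h
  · rw [← h]
    simp
  · have hpos : 0 < q j + t * p i := by have := hq j; positivity
    generalize q j + t * p i = r at *
    simp only [Complex.normSq_apply, Complex.star_def, Complex.mul_re, Complex.conj_re,
      Complex.conj_im, Complex.mul_im, Complex.ofReal_re, Complex.ofReal_im]
    field_simp [hpos.ne']
    ring

end mat
end QRelay
namespace QRelay
section bip
variable {A₁ A B : Type*} [Fintype A₁] [DecidableEq A₁] [Fintype A] [DecidableEq A]
    [Fintype B] [DecidableEq B]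

lemma ptrFst_conj (ρ : Matrix (A₁ × A) (A₁ × A) ℂ) (K : Matrix B A ℂ) :
    ptrFst (((1 : Matrix A₁ A₁ ℂ) ⊗ₖ K) * ρ * ((1 : Matrix A₁ A₁ ℂ) ⊗ₖ K)ᴴ)
      = K * ptrFst ρ * Kᴴ := by
  have h1 : ∀ a b a' b', (((1 : Matrix A₁ A₁ ℂ) ⊗ₖ K) * ρ * ((1 : Matrix A₁ A₁ ℂ) ⊗ₖ K)ᴴ)
      (a, b) (a', b') = ∑ y, ∑ x, K b x * ρ (a, x) (a', y) * star (K b' y) := by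
    intro a b a' b'
    rw [mul_apply, Fintype.sum_prod_type]
    simp only [mul_apply, Fintype.sum_prod_type, kroneckerMap_apply, conjTranspose_apply,
      one_apply, ite_mul, one_mul, zero_mul, Finset.sum_mul]
    rw [Finset.sum_comm]
    refine Finset.sum_congr rfl fun y _ => ?_
    rw [Finset.sum_eq_single a' (by intro c _ hc; simp [Ne.symm hc]) (by simp)]
    rw [Finset.sum_eq_single a (by intro c _ hc; simp [Ne.symm hc]) (by simp)]
    simp
  ext b b'
  simp only [ptrFst, Matrix.of_apply, h1]
  rw [mul_apply, Finset.sum_comm]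
  refine Finset.sum_congr rfl fun y _ => ?_
  rw [mul_apply, Finset.sum_mul, Finset.sum_comm]
  refine Finset.sum_congr rfl fun x _ => ?_
  rw [Matrix.of_apply, Finset.mul_sum, Finset.sum_mul]
  rfl

lemma ptrFst_psd {ρ : Matrix (A₁ × A) (A₁ × A) ℂ} (h : ρ.PosSemidef) :
    (ptrFst ρ).PosSemidef := by
  have : ptrFst ρ = ∑ a : A₁, ρ.submatrix (fun b => (a, b)) (fun b => (a, b)) := by
    ext b b'
    simp [ptrFst, Matrix.sum_apply]
  rw [this]
  exact posSemidef_sum _ fun a _ => h.submatrix _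

lemma ptrFst_sum {ι : Type*} (s : Finset ι) (R : ι → Matrix (A₁ × A) (A₁ × A) ℂ) :
    ptrFst (∑ k ∈ s, R k) = ∑ k ∈ s, ptrFst (R k) := by
  ext b b'
  simp only [ptrFst, Matrix.of_apply, Matrix.sum_apply]
  exact Finset.sum_comm

lemma spec {n : Type*} [Fintype n] [DecidableEq n] {ρ : Matrix n n ℂ} (h : ρ.IsHermitian) :
    ∃ U : Matrix n n ℂ, Uᴴ * U = 1 ∧
      ρ = U * diagonal (fun i => (h.eigenvalues i : ℂ)) * Uᴴ := by
  refine ⟨h.eigenvectorUnitary, ?_, ?_⟩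
  · exact Unitary.coe_star_mul_self h.eigenvectorUnitary
  · exact h.spectral_theorem

lemma diag_conj {n : Type*} [Fintype n] [DecidableEq n] (M : Matrix n n ℂ) (p : n → ℝ) (j : n) :
    (M * diagonal (fun i => (p i : ℂ)) * Mᴴ) j j = ((∑ i, Complex.normSq (M j i) * p i : ℝ) : ℂ) := by
  rw [mul_apply]
  push_cast
  refine Finset.sum_congr rfl fun i _ => ?_
  rw [mul_diagonal, conjTranspose_apply, Complex.star_def, ← Complex.mul_conj]
  ring

lemma sum_logb {n : Type*} [Fintype n] (p : n → ℝ) :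
    ∑ i, p i * Real.log (p i) = -(Real.log 2 * -∑ i, p i * Real.logb 2 (p i)) := by
  have : Real.log 2 ≠ 0 := (Real.log_pos one_lt_two).ne'
  rw [mul_neg, neg_neg, Finset.mul_sum]
  refine Finset.sum_congr rfl fun i _ => ?_
  rw [Real.logb]
  field_simp

lemma vN_eq {n : Type*} [Fintype n] [DecidableEq n] {ρ : Matrix n n ℂ} (h : ρ.IsHermitian) :
    ∑ i, h.eigenvalues i * Real.log (h.eigenvalues i) = -(Real.log 2 * vN ρ) := by
  rw [sum_logb, vN, dif_pos h]

lemma bundle {ρ : Matrix (A₁ × A) (A₁ × A) ℂ} (h : ρ.PosSemidef) (ht : ρ.trace = 1) :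
    ∃ (p q : A₁ × A → ℝ) (U W : Matrix (A₁ × A) (A₁ × A) ℂ), Uᴴ * U = 1 ∧ Wᴴ * W = 1 ∧
      ρ = U * diagonal (fun i => (p i : ℂ)) * Uᴴ ∧
      (1 : Matrix A₁ A₁ ℂ) ⊗ₖ ptrFst ρ = W * diagonal (fun i => (q i : ℂ)) * Wᴴ ∧
      (∀ i, 0 ≤ p i) ∧ (∀ i, 0 ≤ q i) ∧ ∑ i, p i = 1 ∧
      (∀ i, ∑ j, Complex.normSq ((Wᴴ * U) j i) = 1) ∧
      (∀ i j, q j = 0 → Complex.normSq ((Wᴴ * U) j i) * p i = 0) ∧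
      ∑ i, p i * Real.log (p i) = -(Real.log 2 * vN ρ) ∧
      ∑ i, ∑ j, Complex.normSq ((Wᴴ * U) j i) * p i * Real.log (q j)
        = -(Real.log 2 * vN (ptrFst ρ)) := by
  have hA := ptrFst_psd h
  obtain ⟨U, hU, hρ⟩ := spec h.1
  obtain ⟨V, hV, hρA⟩ := spec hA.1
  set p := h.1.eigenvalues with hp
  set r := hA.1.eigenvalues with hr
  set W : Matrix (A₁ × A) (A₁ × A) ℂ := (1 : Matrix A₁ A₁ ℂ) ⊗ₖ V with hWd
  have hWH : Wᴴ = (1 : Matrix A₁ A₁ ℂ) ⊗ₖ Vᴴ := by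
    rw [hWd, conjTranspose_kronecker, conjTranspose_one]
  have hW : Wᴴ * W = 1 := by
    rw [hWH, hWd, ← mul_kronecker_mul, hV, Matrix.one_mul, one_kronecker_one]
  have hU' : U * Uᴴ = 1 := mul_eq_one_comm.1 hU
  have hW' : W * Wᴴ = 1 := mul_eq_one_comm.1 hW
  have hp0 : ∀ i, 0 ≤ p i := h.eigenvalues_nonneg
  have hr0 : ∀ i, 0 ≤ r i := hA.eigenvalues_nonneg
  have marg : ∀ j, ∑ a : A₁, ∑ i, Complex.normSq ((Wᴴ * U) (a, j) i) * p i = r j := by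
    intro j
    have e1 : ptrFst (Wᴴ * ρ * Wᴴᴴ) = diagonal (fun i => (r i : ℂ)) := by
      rw [hWH, ptrFst_conj, hρA]
      simp only [conjTranspose_conjTranspose]
      calc _ = (Vᴴ * V) * diagonal (fun i => (r i : ℂ)) * (Vᴴ * V) := by
            simp only [Matrix.mul_assoc]
        _ = _ := by rw [hV]; simp
    have e2 : Wᴴ * ρ * Wᴴᴴ = (Wᴴ * U) * diagonal (fun i => (p i : ℂ)) * (Wᴴ * U)ᴴ := by
      rw [hρ]
      simp only [conjTranspose_mul, Matrix.mul_assoc]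
    have e3 := congrFun (congrFun e1 j) j
    rw [e2] at e3
    simp only [ptrFst, Matrix.of_apply, diag_conj, diagonal_apply_eq] at e3
    exact_mod_cast e3
  refine ⟨p, fun x => r x.2, U, W, hU, hW, hρ, ?_, hp0, fun _ => hr0 _, ?_, ?_, ?_, vN_eq h.1, ?_⟩
  · have : diagonal (fun i : A₁ × A => (r i.2 : ℂ)) =
        (1 : Matrix A₁ A₁ ℂ) ⊗ₖ diagonal (fun i => (r i : ℂ)) := by
      rw [← diagonal_one, diagonal_kronecker_diagonal]
      simp
    rw [this, hWH, hWd, ← mul_kronecker_mul, ← mul_kronecker_mul, ← hρA]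
    simp
  · have := h.1.trace_eq_sum_eigenvalues
    rw [ht] at this
    have h3 : ((∑ i, p i : ℝ) : ℂ) = 1 := by
      rw [this]; push_cast; rfl
    exact_mod_cast h3
  · intro i
    have e : ((Wᴴ * U)ᴴ * (Wᴴ * U)) i i = 1 := by
      have : (Wᴴ * U)ᴴ * (Wᴴ * U) = 1 := by
        calc _ = Uᴴ * (W * Wᴴ) * U := by
              simp only [conjTranspose_mul, conjTranspose_conjTranspose, Matrix.mul_assoc]
          _ = 1 := by rw [hW', Matrix.mul_one, hU]
      rw [this, one_apply_eq]
    rw [mul_apply] at e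
    have e' : ((∑ j, Complex.normSq ((Wᴴ * U) j i) : ℝ) : ℂ) = 1 := by
      rw [← e]
      push_cast
      refine Finset.sum_congr rfl fun j _ => ?_
      rw [conjTranspose_apply, Complex.star_def, Complex.normSq_eq_conj_mul_self]
    exact_mod_cast e'
  · rintro i ⟨a, j⟩ hj
    have m := marg j
    rw [show r j = 0 from hj] at m
    have nn : ∀ a i, 0 ≤ Complex.normSq ((Wᴴ * U) (a, j) i) * p i :=
      fun a i => mul_nonneg (Complex.normSq_nonneg _) (hp0 i)
    have m1 := (Finset.sum_eq_zero_iff_of_nonneg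
      (fun a _ => Finset.sum_nonneg fun i _ => nn a i)).1 m a (Finset.mem_univ _)
    exact (Finset.sum_eq_zero_iff_of_nonneg (fun i _ => nn a i)).1 m1 i (Finset.mem_univ _)
  · rw [← vN_eq hA.1, Finset.sum_comm, Fintype.sum_prod_type, Finset.sum_comm]
    refine Finset.sum_congr rfl fun j _ => ?_
    change _ = r j * Real.log (r j)
    simp only [← Finset.sum_mul]
    rw [marg j]

end bip
end QRelay

open QRelay in
/-- Data processing for coherent information: applying a CPTP map (given via a
Kraus representation) on the `A` system cannot increase `I(A₁⟩·)`. -/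
theorem coherentInfo_data_processing
    {A₁ A B : Type*} [Fintype A₁] [DecidableEq A₁] [Fintype A] [DecidableEq A]
    [Fintype B] [DecidableEq B]
    (ρ : Matrix (A₁ × A) (A₁ × A) ℂ) (hρ : IsDensity ρ)
    {ι : Type*} (s : Finset ι) (K : ι → Matrix B A ℂ)
    (hK : ∑ k ∈ s, (K k)ᴴ * K k = 1)
    (ρ' : Matrix (A₁ × B) (A₁ × B) ℂ)
    (hρ' : ρ' = ∑ k ∈ s,
      ((1 : Matrix A₁ A₁ ℂ) ⊗ₖ K k) * ρ * ((1 : Matrix A₁ A₁ ℂ) ⊗ₖ K k)ᴴ) :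
    vN (ptrFst ρ') - vN ρ' ≤ vN (ptrFst ρ) - vN ρ := by

  set L : ι → Matrix (A₁ × B) (A₁ × A) ℂ := fun k => (1 : Matrix A₁ A₁ ℂ) ⊗ₖ K k with hLd
  have hL : ∑ k ∈ s, (L k)ᴴ * L k = 1 := by
    have : ∀ k, (L k)ᴴ * L k = (1 : Matrix A₁ A₁ ℂ) ⊗ₖ ((K k)ᴴ * K k) := by
      intro k
      simp only [hLd]
      rw [conjTranspose_kronecker, conjTranspose_one, ← mul_kronecker_mul, Matrix.one_mul]
    simp only [this]
    have h2 : ∑ k ∈ s, (1 : Matrix A₁ A₁ ℂ) ⊗ₖ ((K k)ᴴ * K k)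
        = (1 : Matrix A₁ A₁ ℂ) ⊗ₖ (∑ k ∈ s, (K k)ᴴ * K k) := by
      ext x y
      simp [Matrix.sum_apply, kroneckerMap_apply, Finset.mul_sum]
    rw [h2, hK, one_kronecker_one]
  have hρ'L : ρ' = ∑ k ∈ s, L k * ρ * (L k)ᴴ := hρ'
  have hpsd' : ρ'.PosSemidef := by
    rw [hρ'L]
    exact posSemidef_sum _ fun k _ => hρ.1.mul_mul_conjTranspose_same _
  have htr' : ρ'.trace = 1 := by
    rw [hρ'L, trace_sum, ← hρ.2]
    have : ∀ k ∈ s, (L k * ρ * (L k)ᴴ).trace = ((L k)ᴴ * L k * ρ).trace := by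
      intro k _
      rw [trace_mul_comm, Matrix.mul_assoc]
    rw [Finset.sum_congr rfl this, ← trace_sum, ← Finset.sum_mul, hL, Matrix.one_mul]
  have hσ' : (1 : Matrix A₁ A₁ ℂ) ⊗ₖ ptrFst ρ' =
      ∑ k ∈ s, L k * ((1 : Matrix A₁ A₁ ℂ) ⊗ₖ ptrFst ρ) * (L k)ᴴ := by
    have : ∀ k ∈ s, L k * ((1 : Matrix A₁ A₁ ℂ) ⊗ₖ ptrFst ρ) * (L k)ᴴ
        = (1 : Matrix A₁ A₁ ℂ) ⊗ₖ (K k * ptrFst ρ * (K k)ᴴ) := by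
      intro k _
      simp only [hLd]
      rw [conjTranspose_kronecker, conjTranspose_one, ← mul_kronecker_mul, ← mul_kronecker_mul,
        Matrix.one_mul, Matrix.one_mul]
    rw [Finset.sum_congr rfl this, hρ', ptrFst_sum]
    simp only [ptrFst_conj]
    ext x y
    simp [Matrix.sum_apply, kroneckerMap_apply, Finset.mul_sum]
  obtain ⟨p, q, U, W, hU, hW, e1, e2, hp, hq, hs, hc, hz, v1, v2⟩ := bundle hρ.1 hρ.2
  obtain ⟨p', q', U', W', hU', hW', e1', e2', hp', hq', hs', hc', hz', v1', v2'⟩ :=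
    bundle hpsd' htr'
  have hσ : ((1 : Matrix A₁ A₁ ℂ) ⊗ₖ ptrFst ρ).PosSemidef := by
    rw [e2]
    refine PosSemidef.mul_mul_conjTranspose_same (PosSemidef.diagonal ?_) _
    intro i
    exact Complex.zero_le_real.2 (hq i)
  have main := scalar_main p q (fun i j => Complex.normSq ((Wᴴ * U) j i)) hp hq hc hs hz
    p' q' (fun i j => Complex.normSq ((W'ᴴ * U') j i)) hp' hq' hc' hs' hz' (by
      intro t ht
      obtain ⟨X, hX⟩ := val_attained p' q' U' W' hU' hW' ht hp' hq'
      rw [← hX, ← e1', ← e2', hρ'L, ← hρ'L, hσ', hρ'L]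
      refine (val_le s L hL ρ _ hρ.1 hσ X ht).trans ?_
      have := val_upper p q U W (∑ k ∈ s, (L k)ᴴ * X * L k) hU hW ht hp hq
      rwa [← e1, ← e2] at this)
  rw [v1, v2, v1', v2'] at main
  have hl : 0 < Real.log 2 := Real.log_pos one_lt_two
  refine le_of_mul_le_mul_left ?_ hl
  linarith
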